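/- Let 𝒢 be a class of finite forests of bounded height, and let d denote the stack depth of 𝒢. Then either 𝒢 ≡ 𝒯_d or 𝒢 ≡ ℱ_d. -/

import Mathlib

open SimpleGraph

/-- The reflexive closure of the adjacency relation of a graph. -/
def reflAdj {α : Type} (G : SimpleGraph α) (a b : α) : Prop := a = b ∨ G.Adj a b

/-- A set of vertices induces a connected subgraph of `G`. -/
def ConnSet {α : Type} (G : SimpleGraph α) (s : Set α) : Prop := (G.induce s).Connected

/-- `B` is an `H`-deconstruction of `G`: coverage and connectivity. -/
def IsDeconstruction {α β : Type} (G : SimpleGraph α) (H : SimpleGraph β)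
    (B : β → Set α) : Prop :=
  (∀ g g' : α, reflAdj G g g' →
      ∃ h h' : β, reflAdj H h h' ∧ g ∈ B h ∪ B h' ∧ g' ∈ B h ∪ B h') ∧
  (∀ g : α, ConnSet H {h | g ∈ B h})

/-- The family `B` (viewed as an `H`-indexed family of bags) has width at most `w`. -/
def DeconWidthLE {α β : Type} (H : SimpleGraph β) (B : β → Set α) (w : ℕ) : Prop :=
  ∀ h h' : β, reflAdj H h h' → (B h ∪ B h').ncard ≤ w

/-- `B` is an `H`-decomposition of `G`: each (refl-)edge inside a single bag, plus
connectivity. -/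
def IsDecomposition {α β : Type} (G : SimpleGraph α) (H : SimpleGraph β)
    (B : β → Set α) : Prop :=
  (∀ g g' : α, reflAdj G g g' → ∃ h : β, g ∈ B h ∧ g' ∈ B h) ∧
  (∀ g : α, ConnSet H {h | g ∈ B h})

/-- A finite simple graph, presented on a vertex set `Fin n`. -/
structure FinGraph where
  n : ℕ
  G : SimpleGraph (Fin n)

/-- `𝒢 ≼ ℋ` : every graph in `𝒢` has an `H`-deconstruction of width `≤ w`
for some `H ∈ ℋ`, for a uniform constant `w`. -/
def DeconLE (𝒢 ℋ : Set FinGraph) : Prop :=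
  ∃ w : ℕ, ∀ G ∈ 𝒢, ∃ H ∈ ℋ, ∃ B : Fin H.n → Set (Fin G.n),
    IsDeconstruction G.G H.G B ∧ DeconWidthLE H.G B w

/-- `𝒢 ≡ ℋ`. -/
def DeconEquiv (𝒢 ℋ : Set FinGraph) : Prop := DeconLE 𝒢 ℋ ∧ DeconLE ℋ 𝒢

/-- `𝒢 ≺ ℋ`. -/
def DeconLT (𝒢 ℋ : Set FinGraph) : Prop := DeconLE 𝒢 ℋ ∧ ¬ DeconEquiv 𝒢 ℋ

/-- `μ` is a minor map from `M` to `G`. -/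
def IsMinorMap {α β : Type} (M : SimpleGraph α) (G : SimpleGraph β)
    (μ : α → Set β) : Prop :=
  (∀ m : α, ConnSet G (μ m)) ∧
  (∀ m m' : α, m ≠ m' → Disjoint (μ m) (μ m')) ∧
  (∀ m m' : α, M.Adj m m' → ∃ g ∈ μ m, ∃ g' ∈ μ m', G.Adj g g')

/-- `M` is a minor of `G`. -/
def IsMinor (M G : FinGraph) : Prop :=
  ∃ μ : Fin M.n → Set (Fin G.n), IsMinorMap M.G G.G μ

/-- The class of all minors of graphs in `𝒢`. -/
def minorsCl (𝒢 : Set FinGraph) : Set FinGraph := {M | ∃ G ∈ 𝒢, IsMinor M G}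

/-- The (connected) graph `G`, viewed as a tree, has height at most `d`:
some rooting puts every vertex within distance `d` of the root. -/
def treeHeightLE (G : FinGraph) (d : ℕ) : Prop :=
  ∃ r : Fin G.n, ∀ v : Fin G.n, G.G.dist r v ≤ d

/-- Every connected component of `G` has height at most `d`. -/
def forestHeightLE (G : FinGraph) (d : ℕ) : Prop :=
  ∀ v : Fin G.n, ∃ r : Fin G.n, G.G.Reachable r v ∧
    ∀ u : Fin G.n, G.G.Reachable r u → G.G.dist r u ≤ d

/-- `ℒ` : the class of all finite simple graphs. -/
def classL : Set FinGraph := Set.univ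

/-- `𝒯` : the class of all finite trees. -/
def classT : Set FinGraph := {G | G.G.IsTree}

/-- `𝒫` : the class of all finite paths (on at least two vertices). -/
def classP : Set FinGraph := {G | ∃ m : ℕ, 2 ≤ m ∧ Nonempty (G.G ≃g pathGraph m)}

/-- `𝒯_d` : all finite trees of height at most `d`. -/
def classTd (d : ℕ) : Set FinGraph := {G | G.G.IsTree ∧ treeHeightLE G d}

/-- `ℱ_d` : all finite forests of height at most `d`. -/
def classFd (d : ℕ) : Set FinGraph := {G | G.G.IsAcyclic ∧ forestHeightLE G d}

/-- The complete `k`-ary tree `T_{h,k}` of height `h`, on strings over `[k]` of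
length at most `h`; each string of length `< h` is joined to its one-symbol extensions. -/
def kAryTree (h k : ℕ) : SimpleGraph {l : List (Fin k) // l.length ≤ h} :=
  SimpleGraph.fromRel (fun a b => ∃ i : Fin k, b.1 = i :: a.1)

/-- For every `k ≥ 1`, the tree `T_{h,k}` is a minor of some graph in `𝒢`. -/
def StackAll (𝒢 : Set FinGraph) (h : ℕ) : Prop :=
  ∀ k : ℕ, 1 ≤ k → ∃ G ∈ 𝒢, ∃ μ : {l : List (Fin k) // l.length ≤ h} → Set (Fin G.n),
    IsMinorMap (kAryTree h k) G.G μ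

/-- `𝒢` has stack depth (exactly) `d`. -/
def HasStackDepth (𝒢 : Set FinGraph) (d : ℕ) : Prop :=
  StackAll 𝒢 d ∧ ¬ StackAll 𝒢 (d + 1)

/-- The tree depth of `G` is at most `h`: there is a rooted forest on the vertex
set of `G` (given by a parent function whose fixed points are the roots) of height
at most `h` whose (ancestor-descendant) closure contains all edges of `G`. -/
def TreeDepthLE {α : Type} (G : SimpleGraph α) (h : ℕ) : Prop :=
  ∃ par : α → α,
    (∀ v : α, par (par^[h] v) = par^[h] v) ∧
    (∀ u v : α, G.Adj u v → (∃ k : ℕ, par^[k] u = v) ∨ (∃ k : ℕ, par^[k] v = u))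

/-- The class `𝒢` has bounded tree depth. -/
def HasBoundedTreeDepth (𝒢 : Set FinGraph) : Prop :=
  ∃ h : ℕ, ∀ G ∈ 𝒢, TreeDepthLE G.G h

/-- The class `𝒢` has bounded treewidth (via tree decompositions). -/
def HasBoundedTreewidth (𝒢 : Set FinGraph) : Prop :=
  ∃ w : ℕ, ∀ G ∈ 𝒢, ∃ H : FinGraph, H.G.IsTree ∧
    ∃ B : Fin H.n → Set (Fin G.n), IsDecomposition G.G H.G B ∧ ∀ h, (B h).ncard ≤ w + 1

/-- The class `𝒢` has bounded pathwidth (via path decompositions). -/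
def HasBoundedPathwidth (𝒢 : Set FinGraph) : Prop :=
  ∃ w : ℕ, ∀ G ∈ 𝒢, ∃ H : FinGraph, H ∈ classP ∧
    ∃ B : Fin H.n → Set (Fin G.n), IsDecomposition G.G H.G B ∧ ∀ h, (B h).ncard ≤ w + 1

/-- A finite rooted tree. -/
structure RootedFinTree where
  n : ℕ
  G : SimpleGraph (Fin n)
  isTree : G.IsTree
  root : Fin n

/-- `c` is a child of `p` in the rooted tree `T`. -/
def RootedFinTree.IsChild (T : RootedFinTree) (p c : Fin T.n) : Prop :=
  T.G.Adj p c ∧ T.G.dist T.root c = T.G.dist T.root p + 1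

/-- `a` is an ancestor of `v` in the rooted tree `T` (i.e. `a` lies on the unique
path from the root to `v`). -/
def RootedFinTree.Ancestor (T : RootedFinTree) (a v : Fin T.n) : Prop :=
  T.G.dist T.root v = T.G.dist T.root a + T.G.dist a v

/-- `(μ m)_{m}` is a nice `M`-deconstruction of `G`, for rooted trees `M`, `G`. -/
def IsNiceDecon (M G : RootedFinTree) (μ : Fin M.n → Set (Fin G.n)) : Prop :=
  IsDeconstruction G.G M.G μ ∧
  IsMinorMap M.G G.G μ ∧
  G.root ∈ μ M.root ∧
  (∀ (m m' : Fin M.n) (g g' : Fin G.n),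
    M.IsChild m m' → g ∈ μ m → g' ∈ μ m' → G.G.Adj g g' → G.IsChild g g')

/-- The node `u` of the rooted tree `T` has property `P(d,k)`. -/
def PropP (T : RootedFinTree) (k : ℕ) : ℕ → Fin T.n → Prop
  | 0, _ => True
  | d + 1, u => ∃ s : Finset (Fin T.n), s.card = k ∧
      (∀ v ∈ s, T.Ancestor u v) ∧
      (∀ v ∈ s, ∀ w ∈ s, v ≠ w → ¬ T.Ancestor v w ∧ ¬ T.Ancestor w v) ∧
      (∀ v ∈ s, PropP T k d v)

/-! ### Parent structures -/

/-- Descendant relation: `PDesc par x v` means that `v` is an ancestor of `x`. -/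
def PDesc {V : Type} (par : V → Option V) : V → V → Prop :=
  Relation.ReflTransGen (fun a b => par a = some b)

/-- The graph of a parent function. -/
def parGraph {V : Type} (par : V → Option V) : SimpleGraph V :=
  SimpleGraph.fromRel (fun u v => par u = some v)

lemma PDesc.dep_le {V : Type} {par : V → Option V} {dep : V → ℕ}
    (hdep : ∀ v p, par v = some p → dep p < dep v) {x v : V} (h : PDesc par x v) :
    dep v ≤ dep x := by
  induction h with
  | refl => exact le_rfl
  | tail _ h2 ih => exact (hdep _ _ h2).le.trans ih

lemma PDesc.not_of_sibling {V : Type} {par : V → Option V} {dep : V → ℕ}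
    (hdep : ∀ v p, par v = some p → dep p < dep v) {a b : V} (hab : a ≠ b)
    (hp : par a = par b) : ¬ PDesc par a b := by
  intro h
  rcases Relation.ReflTransGen.cases_head h with h | ⟨c, hc, hcb⟩
  · exact hab h
  · have h1 := PDesc.dep_le hdep hcb
    have h2 := hdep b c (hp ▸ hc)
    omega

lemma PDesc.disjoint_sibling {V : Type} {par : V → Option V} {dep : V → ℕ}
    (hdep : ∀ v p, par v = some p → dep p < dep v) {a b : V} (hab : a ≠ b)
    (hp : par a = par b) : Disjoint {x | PDesc par x a} {x | PDesc par x b} := by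
  rw [Set.disjoint_left]
  intro x hx hy
  have U : Relator.RightUnique (fun a b => par a = some b) := by
    intro a b c h1 h2
    simpa using h1.symm.trans h2
  rcases Relation.ReflTransGen.total_of_right_unique U hx hy with h | h
  · exact PDesc.not_of_sibling hdep hab hp h
  · exact PDesc.not_of_sibling hdep hab.symm hp.symm h

lemma parGraph_adj {V : Type} {par : V → Option V} {dep : V → ℕ}
    (hdep : ∀ v p, par v = some p → dep p < dep v) (u v : V) :
    (parGraph par).Adj u v ↔ (par u = some v ∨ par v = some u) := by
  unfold parGraph
  rw [SimpleGraph.fromRel_adj]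
  constructor
  · exact fun h => h.2
  · intro h
    refine ⟨?_, h⟩
    rintro rfl
    rcases h with h | h <;> exact absurd (hdep _ _ h) (lt_irrefl _)

lemma parGraph_walk {V : Type} {par : V → Option V} {dep : V → ℕ}
    (hdep : ∀ v p, par v = some p → dep p < dep v) {u r : V} (h : PDesc par u r) :
    ∃ w : (parGraph par).Walk u r, w.length + dep r ≤ dep u := by
  induction h using Relation.ReflTransGen.head_induction_on with
  | refl => exact ⟨.nil, by simp⟩
  | head h1 _ ih =>
    obtain ⟨w, hw⟩ := ih
    refine ⟨.cons ((parGraph_adj hdep _ _).2 (Or.inl h1)) w, ?_⟩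
    have := hdep _ _ h1
    simp only [SimpleGraph.Walk.length_cons]
    omega

lemma exists_root {V : Type} {par : V → Option V} {dep : V → ℕ}
    (hdep : ∀ v p, par v = some p → dep p < dep v) (v : V) :
    ∃ r, par r = none ∧ PDesc par v r := by
  induction hn : dep v using Nat.strong_induction_on generalizing v with
  | _ n ih =>
    subst hn
    cases hv : par v with
    | none => exact ⟨v, hv, .refl⟩
    | some p =>
      obtain ⟨r, hr, hpr⟩ := ih _ (hdep _ _ hv) p rfl
      exact ⟨r, hr, .head hv hpr⟩

lemma parGraph_acyclic {V : Type} {par : V → Option V} {dep : V → ℕ}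
    (hdep : ∀ v p, par v = some p → dep p < dep v) : (parGraph par).IsAcyclic := by
  have key : ∀ v p, par v = some p →
      ¬ ((parGraph par).deleteEdges {s(v, p)}).Reachable v p := by
    intro v p hvp hr
    have : ∀ x y, PDesc par x v → ((parGraph par).deleteEdges {s(v, p)}).Walk x y →
        PDesc par y v := by
      intro x y hx w
      induction w with
      | nil => exact hx
      | cons hadj _ ih =>
        apply ih
        rw [SimpleGraph.deleteEdges_adj, parGraph_adj hdep] at hadj
        obtain ⟨h1, h2⟩ := hadj
        rcases h1 with h1 | h1
        · rcases Relation.ReflTransGen.cases_head hx with h | ⟨c, hc, hcb⟩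
          · subst h
            rw [hvp] at h1
            simp only [Option.some.injEq] at h1
            subst h1
            simp at h2
          · rw [hc] at h1
            simp only [Option.some.injEq] at h1
            subst h1
            exact hcb
        · exact .head h1 hx
    obtain ⟨w⟩ := hr
    have h1 := PDesc.dep_le hdep (this v p .refl w)
    have h2 := hdep _ _ hvp
    omega
  rw [SimpleGraph.isAcyclic_iff_forall_adj_isBridge]
  intro u v huv
  rw [parGraph_adj hdep] at huv
  rcases huv with h | h
  · exact key _ _ h
  · rw [Sym2.eq_swap]
    exact key _ _ h

lemma parGraph_reach_root {V : Type} {par : V → Option V} {dep : V → ℕ}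
    (hdep : ∀ v p, par v = some p → dep p < dep v) {r u : V} (hr : par r = none)
    (h : (parGraph par).Reachable r u) : PDesc par u r := by
  have : ∀ x y, PDesc par x r → (parGraph par).Walk x y → PDesc par y r := by
    intro x y hx w
    induction w with
    | nil => exact hx
    | cons hadj _ ih =>
      apply ih
      rw [parGraph_adj hdep] at hadj
      rcases hadj with h1 | h1
      · rcases Relation.ReflTransGen.cases_head hx with h | ⟨c, hc, hcb⟩
        · subst h
          rw [hr] at h1
          simp at h1
        · rw [hc] at h1
          simp only [Option.some.injEq] at h1
          subst h1
          exact hcb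
      · exact .head h1 hx
  obtain ⟨w⟩ := h
  exact this r u .refl w

lemma parGraph_mem_Fd {n d : ℕ} {par : Fin n → Option (Fin n)} {dep : Fin n → ℕ}
    (hdep : ∀ v p, par v = some p → dep p < dep v) (hd : ∀ v, dep v ≤ d) :
    (⟨n, parGraph par⟩ : FinGraph) ∈ classFd d := by
  refine ⟨parGraph_acyclic hdep, ?_⟩
  intro v
  obtain ⟨r, hr, hvr⟩ := exists_root hdep v
  obtain ⟨w, -⟩ := parGraph_walk hdep hvr
  refine ⟨r, w.reachable.symm, ?_⟩
  intro u hu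
  obtain ⟨w, hw⟩ := parGraph_walk hdep (parGraph_reach_root hdep hr hu)
  have := SimpleGraph.dist_le w.reverse
  rw [SimpleGraph.Walk.length_reverse] at this
  have := hd u
  dsimp only at *
  omega

lemma parGraph_mem_Td {n d : ℕ} {par : Fin n → Option (Fin n)} {dep : Fin n → ℕ}
    (hdep : ∀ v p, par v = some p → dep p < dep v) (hd : ∀ v, dep v ≤ d)
    (r : Fin n) (hroot : ∀ v, par v = none → v = r) :
    (⟨n, parGraph par⟩ : FinGraph) ∈ classTd d := by
  have hD : ∀ u, PDesc par u r := by
    intro u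
    obtain ⟨r', hr', hu⟩ := exists_root hdep u
    exact hroot r' hr' ▸ hu
  have hR : ∀ u, (parGraph par).Reachable u r := fun u =>
    (parGraph_walk hdep (hD u)).choose.reachable
  refine ⟨⟨?_, parGraph_acyclic hdep⟩, r, ?_⟩
  · have : Nonempty (Fin n) := ⟨r⟩
    exact ⟨fun u v => (hR u).trans (hR v).symm⟩
  · intro u
    obtain ⟨w, hw⟩ := parGraph_walk hdep (hD u)
    have := SimpleGraph.dist_le w.reverse
    rw [SimpleGraph.Walk.length_reverse] at this
    have := hd u
    dsimp only at *
    omega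

/-! ### Every forest of bounded height is given by a parent structure -/

lemma closer_unique {V : Type} {G : SimpleGraph V} (hG : G.IsAcyclic) {r v p p' : V}
    (hr : G.Reachable r v) (hp : G.Adj v p) (hp' : G.Adj v p')
    (hlt : G.dist r p < G.dist r v) (hlt' : G.dist r p' < G.dist r v) : p = p' := by
  obtain ⟨q, hq, hq'⟩ := hr.exists_path_of_dist
  have key : ∀ p, G.Adj v p → G.dist r p < G.dist r v → p = q.penultimate := by
    intro p hp hlt
    apply hG.eq_penultimate_of_adj_end hq hp
    by_contra hns
    obtain ⟨s, hs, hs'⟩ := (hr.trans hp.reachable).exists_path_of_dist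
    have hv := hG.mem_support_of_ne_mem_support_of_adj_of_isPath hs hq hp.symm hns
    have := hG.path_concat hq hs hp hv
    have h2 := congrArg SimpleGraph.Walk.length this
    rw [SimpleGraph.Walk.length_concat] at h2
    omega
  rw [key p hp hlt, key p' hp' hlt']

lemma exists_par (F : FinGraph) (e : ℕ) (hF : F.G.IsAcyclic) (hh : forestHeightLE F e) :
    ∃ (par : Fin F.n → Option (Fin F.n)) (dep : Fin F.n → ℕ),
      (∀ v p, par v = some p → dep p < dep v) ∧ (∀ v, dep v ≤ e) ∧
      (∀ u v, F.G.Adj u v ↔ (par u = some v ∨ par v = some u)) ∧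
      (∀ u v, par u = none → par v = none → F.G.Reachable u v → u = v) := by
  classical
  choose r hr1 hr2 using hh
  let c : Fin F.n → Fin F.n := fun v => Quot.out (F.G.connectedComponentMk v)
  have hc : ∀ v, F.G.Reachable (c v) v := fun v =>
    SimpleGraph.ConnectedComponent.exact (Quot.out_eq (F.G.connectedComponentMk v))
  have hcc : ∀ u v, F.G.Reachable u v → c u = c v := by
    intro u v h
    have : F.G.connectedComponentMk u = F.G.connectedComponentMk v :=
      SimpleGraph.ConnectedComponent.sound h
    simp only [c, this]
  let rt : Fin F.n → Fin F.n := fun v => r (c v)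
  have hrt : ∀ v, F.G.Reachable (rt v) v := fun v => (hr1 (c v)).trans (hc v)
  have hrtc : ∀ u v, F.G.Reachable u v → rt u = rt v := fun u v h => by
    simp only [rt, hcc u v h]
  let dep : Fin F.n → ℕ := fun v => F.G.dist (rt v) v
  let par : Fin F.n → Option (Fin F.n) := fun v =>
    if h : ∃ p, F.G.Adj v p ∧ dep p < dep v then some h.choose else none
  have hpar : ∀ v p, par v = some p ↔ (F.G.Adj v p ∧ dep p < dep v) := by
    intro v p
    simp only [par]
    split_ifs with h
    · have hs := h.choose_spec
      simp only [Option.some.injEq]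
      constructor
      · rintro rfl
        exact hs
      · rintro ⟨h1, h2⟩
        have e1 := hrtc _ _ hs.1.reachable
        have e2 := hrtc _ _ h1.reachable
        have hs2 := hs.2
        simp only [dep] at hs2 h2
        rw [← e1] at hs2
        rw [← e2] at h2
        exact closer_unique hF (hrt v) hs.1 h1 hs2 h2
    · simp only [reduceCtorEq, false_iff]
      exact fun h' => h ⟨p, h'⟩
  have hnone : ∀ v, par v = none → v = rt v := by
    intro v hv
    by_contra hne
    obtain ⟨w, hw⟩ := (hrt v).symm.exists_walk_length_eq_dist
    generalize hx : rt v = x at w hw hne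
    cases w with
    | nil => exact hne rfl
    | @cons _ p _ hadj q =>
      have e1 := hrtc _ _ hadj.reachable
      have : par v = some p := by
        rw [hpar]
        refine ⟨hadj, ?_⟩
        simp only [dep]
        rw [← e1, hx, SimpleGraph.dist_comm, SimpleGraph.dist_comm (u := x), ← hw]
        have := SimpleGraph.dist_le q
        simp only [SimpleGraph.Walk.length_cons]
        omega
      rw [hv] at this
      simp at this
  refine ⟨par, dep, fun v p h => ((hpar v p).1 h).2, ?_, ?_, ?_⟩
  · intro v
    exact hr2 (c v) v (hrt v)
  · intro u v
    rw [hpar, hpar]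
    constructor
    · intro h
      have e1 := hrtc _ _ h.reachable
      have : dep u ≠ dep v := by
        simp only [dep]
        rw [← e1]
        exact hF.dist_ne_of_adj h (hrt u)
      rcases lt_or_gt_of_ne this with h' | h'
      · exact Or.inr ⟨h.symm, h'⟩
      · exact Or.inl ⟨h, h'⟩
    · rintro (h | h)
      · exact h.1
      · exact h.1.symm
  · intro u v hu hv huv
    rw [hnone u hu, hnone v hv]
    exact hrtc _ _ huv

/-! ### Good vertices and the minors they give -/

/-- `PGood par k j v`: the subtree below `v` has a `T_{j,k}` minor, combinatorially. -/
inductive PGood {V : Type} (par : V → Option V) (k : ℕ) : ℕ → V → Prop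
  | zero (v : V) : PGood par k 0 v
  | step (j : ℕ) (v : V) (c : Fin k → V) (hinj : Function.Injective c)
      (hc : ∀ i, par (c i) = some v) (hg : ∀ i, PGood par k j (c i)) : PGood par k (j + 1) v
  | up (j : ℕ) (v p : V) (hp : par v = some p) (hg : PGood par k j v) : PGood par k j p

lemma connSet_singleton {V : Type} (G : SimpleGraph V) (v : V) : ConnSet G {v} := by
  unfold ConnSet
  have : Nonempty ({v} : Set V) := ⟨⟨v, rfl⟩⟩
  exact ⟨fun a b => by
    have : a = b := Subsingleton.elim _ _
    rw [this]⟩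

lemma connSet_insert {V : Type} {G : SimpleGraph V} {s : Set V} {v p : V} (hs : ConnSet G s)
    (hv : v ∈ s) (h : G.Adj v p) : ConnSet G (insert p s) := by
  have := SimpleGraph.induce_union_connected
    (SimpleGraph.induce_pair_connected_of_adj h).preconnected
    (show (G.induce s).Connected from hs).preconnected ⟨v, by simp, hv⟩
  have h2 : ({v, p} ∪ s : Set V) = insert p s := by
    ext x
    simp only [Set.mem_union, Set.mem_insert_iff, Set.mem_singleton_iff]
    constructor
    · rintro ((rfl | h) | h)
      · exact Or.inr hv
      · exact Or.inl h
      · exact Or.inr h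
    · rintro (h | h)
      · exact Or.inl (Or.inr h)
      · exact Or.inr h
  rw [h2] at this
  exact this

/-- A system of branch sets indexed by (top-down) strings. -/
def StrMinor {V : Type} (G : SimpleGraph V) (k j : ℕ) (S : Set V) (v : V)
    (ν : List (Fin k) → Set V) : Prop :=
  v ∈ ν [] ∧
  (∀ l, l.length ≤ j → ConnSet G (ν l) ∧ ν l ⊆ S) ∧
  (∀ l l', l.length ≤ j → l'.length ≤ j → l ≠ l' → Disjoint (ν l) (ν l')) ∧
  (∀ l i, l.length < j → ∃ g ∈ ν l, ∃ g' ∈ ν (l ++ [i]), G.Adj g g')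

lemma PGood.strMinor {V : Type} {G : SimpleGraph V} {par : V → Option V} {dep : V → ℕ}
    (hdep : ∀ v p, par v = some p → dep p < dep v)
    (hadj : ∀ u v, par u = some v → G.Adj u v) {k j : ℕ} {v : V} (h : PGood par k j v) :
    ∃ ν, StrMinor G k j {x | PDesc par x v} v ν := by
  have hnot : ∀ v p, par v = some p → ¬ PDesc par p v := by
    intro v p h h'
    have h1 := PDesc.dep_le hdep h'
    have h2 := hdep _ _ h
    omega
  induction h with
  | zero v =>
    refine ⟨fun _ => {v}, rfl, ?_, ?_, ?_⟩
    · intro l _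
      refine ⟨connSet_singleton G v, ?_⟩
      rintro x rfl
      exact Relation.ReflTransGen.refl
    · intro l l' h1 h2 h3
      simp only [nonpos_iff_eq_zero, List.length_eq_zero_iff] at h1 h2
      exact absurd (h1.trans h2.symm) h3
    · intro l i h
      omega
  | step j v c hinj hc hg ih =>
    choose ν hν using ih
    refine ⟨fun l => match l with
      | [] => {v}
      | i :: l => ν i l, rfl, ?_, ?_, ?_⟩
    · intro l hl
      cases l with
      | nil =>
        refine ⟨connSet_singleton G v, ?_⟩
        rintro x rfl
        exact Relation.ReflTransGen.refl
      | cons i l =>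
        have := (hν i).2.1 l (by simpa using hl)
        refine ⟨this.1, fun x hx => ?_⟩
        exact Relation.ReflTransGen.tail (this.2 hx) (hc i)
    · have hroot : ∀ i l, l.length ≤ j → v ∉ ν i l := by
        intro i l hl hv
        exact hnot _ _ (hc i) (((hν i).2.1 l hl).2 hv)
      intro l l' h1 h2 h3
      cases l with
      | nil =>
        cases l' with
        | nil => exact absurd rfl h3
        | cons i' l' =>
          simp only [Set.disjoint_singleton_left]
          exact hroot _ _ (by simpa using h2)
      | cons i l =>
        cases l' with
        | nil =>
          simp only [Set.disjoint_singleton_right]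
          exact hroot _ _ (by simpa using h1)
        | cons i' l' =>
          have h1' : l.length ≤ j := by simpa using h1
          have h2' : l'.length ≤ j := by simpa using h2
          by_cases hi : i = i'
          · subst hi
            exact (hν i).2.2.1 l l' h1' h2' (fun h => h3 (by rw [h]))
          · have := PDesc.disjoint_sibling hdep (hinj.ne hi) ((hc i).trans (hc i').symm)
            exact this.mono ((hν i).2.1 l h1').2 ((hν i').2.1 l' h2').2
    · intro l i hl
      cases l with
      | nil => exact ⟨v, rfl, c i, (hν i).1, (hadj _ _ (hc i)).symm⟩
      | cons i' l => exact (hν i').2.2.2 l i (by simpa using hl)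
  | up j v p hp hg ih =>
    obtain ⟨ν, h0, h1, h2, h3⟩ := ih
    have hroot : ∀ l, l.length ≤ j → p ∉ ν l := by
      intro l hl hv
      exact hnot _ _ hp ((h1 l hl).2 hv)
    refine ⟨fun l => match l with
      | [] => insert p (ν [])
      | i :: l => ν (i :: l), Set.mem_insert _ _, ?_, ?_, ?_⟩
    · intro l hl
      have hsub : ν l ⊆ {x | PDesc par x p} := fun x hx =>
        Relation.ReflTransGen.tail ((h1 l hl).2 hx) hp
      cases l with
      | nil =>
        refine ⟨connSet_insert (h1 [] hl).1 h0 (hadj _ _ hp), ?_⟩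
        exact Set.insert_subset Relation.ReflTransGen.refl hsub
      | cons i l => exact ⟨(h1 _ hl).1, hsub⟩
    · intro l l' hl hl' hne
      have := h2 l l' hl hl' hne
      cases l with
      | nil =>
        cases l' with
        | nil => exact absurd rfl hne
        | cons i' l' =>
          simp only [Set.disjoint_insert_left]
          exact ⟨hroot _ hl', this⟩
      | cons i l =>
        cases l' with
        | nil =>
          simp only [Set.disjoint_insert_right]
          exact ⟨hroot _ hl, this⟩
        | cons i' l' => exact this
    · intro l i hl
      have := h3 l i hl
      cases l with
      | nil =>
        obtain ⟨g, hg, g', hg', hgg⟩ := this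
        exact ⟨g, Set.mem_insert_of_mem _ hg, g', hg', hgg⟩
      | cons i' l => exact this

lemma StrMinor.isMinorMap {V : Type} {G : SimpleGraph V} {k j : ℕ} {S : Set V} {v : V}
    {ν : List (Fin k) → Set V} (h : StrMinor G k j S v ν) :
    IsMinorMap (kAryTree j k) G (fun l => ν l.1.reverse) := by
  obtain ⟨-, h1, h2, h3⟩ := h
  have key : ∀ (m m' : {l : List (Fin k) // l.length ≤ j}), (∃ i : Fin k, m'.1 = i :: m.1) →
      ∃ g ∈ ν m.1.reverse, ∃ g' ∈ ν m'.1.reverse, G.Adj g g' := by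
    rintro m m' ⟨i, hi⟩
    rw [hi, List.reverse_cons]
    apply h3
    have := m'.2
    rw [hi] at this
    simp only [List.length_cons] at this
    rw [List.length_reverse]
    omega
  refine ⟨fun m => (h1 _ (by simpa using m.2)).1, ?_, ?_⟩
  · intro m m' hne
    apply h2 _ _ (by simpa using m.2) (by simpa using m'.2)
    intro h
    exact hne (Subtype.ext (List.reverse_injective h))
  · intro m m' hmm
    unfold kAryTree at hmm
    rw [SimpleGraph.fromRel_adj] at hmm
    rcases hmm.2 with h | h
    · exact key _ _ h
    · obtain ⟨g, hg, g', hg', hgg⟩ := key _ _ h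
      exact ⟨g', hg', g, hg, hgg.symm⟩

/-! ### Contracting along a rank function -/

lemma fiber_iterate {V : Type} [Finite V] (f : V → V) (k : ℕ)
    (hf : ∀ h, {v | f v = h}.ncard ≤ k) (j : ℕ) (h : V) :
    {v | f^[j] v = h}.ncard ≤ k ^ j := by
  classical
  have := Fintype.ofFinite V
  induction j with
  | zero => simp
  | succ j ih =>
    have hs : ∀ s : Set V, s.ncard = (Finset.univ.filter (· ∈ s)).card := by
      intro s
      rw [← Set.ncard_coe_finset]
      simp
    rw [hs] at ih ⊢
    rw [pow_succ']
    refine le_trans (Finset.card_le_mul_card_image_of_maps_to (f := f)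
      (t := Finset.univ.filter (· ∈ {v | f^[j] v = h})) ?_ k ?_) (Nat.mul_le_mul_left _ ih)
    · intro a ha
      simp only [Finset.mem_filter, Finset.mem_univ, true_and] at ha ⊢
      exact ha
    · intro b _
      refine le_trans ?_ (hf b)
      rw [hs]
      apply Finset.card_le_card
      intro x hx
      simp only [Finset.mem_filter, Finset.mem_univ, true_and] at hx ⊢
      exact hx.2

lemma contract {V : Type} [Finite V] (par : V → Option V) (dep : V → ℕ)
    (hdep : ∀ v p, par v = some p → dep p < dep v) (e d k : ℕ) (he : ∀ v, dep v ≤ e)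
    (ρ : V → ℕ) (hρ : ∀ v, ρ v ≤ d) (hmono : ∀ v p, par v = some p → ρ v ≤ ρ p)
    (hfew : ∀ p, {v | par v = some p ∧ ρ v = ρ p}.ncard ≤ k) :
    ∃ (H : FinGraph) (t : V → Fin H.n), H ∈ classFd d ∧
      (∀ v p, par v = some p → reflAdj H.G (t v) (t p)) ∧
      (∀ h, {v | t v = h}.ncard ≤ (k + 1) ^ e) ∧
      (∀ r, par r = none → (∀ v, par v = none → v = r) → H ∈ classTd d) := by
  classical
  have := Fintype.ofFinite V
  let f : V → V := fun v => match par v with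
    | none => v
    | some p => if ρ v = ρ p then p else v
  have f_none : ∀ v, par v = none → f v = v := by
    intro v h
    simp only [f, h]
  have f_eq : ∀ v p, par v = some p → ρ v = ρ p → f v = p := by
    intro v p h h'
    simp only [f, h, h', if_true]
  have f_ne : ∀ v p, par v = some p → ρ v ≠ ρ p → f v = v := by
    intro v p h h'
    simp only [f, h, h', if_false]
  have f_cases : ∀ v, f v = v ∨ (par v = some (f v) ∧ ρ v = ρ (f v)) := by
    intro v
    cases h : par v with
    | none => exact Or.inl (f_none v h)
    | some p =>
      by_cases h' : ρ v = ρ p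
      · right
        rw [f_eq v p h h']
        exact ⟨rfl, h'⟩
      · exact Or.inl (f_ne v p h h')
  have fρ : ∀ j v, ρ (f^[j] v) = ρ v := by
    intro j
    induction j with
    | zero => intro v; rfl
    | succ j ih =>
      intro v
      rw [Function.iterate_succ_apply, ih]
      rcases f_cases v with h | h
      · rw [h]
      · exact h.2.symm
  have ffix : ∀ j v, dep v ≤ j → f (f^[j] v) = f^[j] v := by
    intro j
    induction j with
    | zero =>
      intro v hv
      rcases f_cases v with h | h
      · simpa using h
      · have := hdep _ _ h.1
        omega
    | succ j ih =>
      intro v hv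
      rw [Function.iterate_succ_apply]
      rcases f_cases v with h | h
      · rw [h, Function.iterate_fixed h, h]
      · apply ih
        have := hdep _ _ h.1
        omega
  let T := {h : V // f h = h}
  let t : V → T := fun v => ⟨f^[e] v, ffix e v (he v)⟩
  have tρ : ∀ v, ρ (t v).1 = ρ v := fun v => fρ e v
  have tf : ∀ v, t (f v) = t v := by
    intro v
    apply Subtype.ext
    change f^[e] (f v) = f^[e] v
    rw [← Function.iterate_succ_apply, Function.iterate_succ_apply']
    exact ffix e v (he v)
  have tT : ∀ h : T, t h.1 = h := by
    intro h
    apply Subtype.ext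
    exact Function.iterate_fixed h.2 e
  let E : T ≃ Fin (Fintype.card T) := Fintype.equivFin T
  let par' : Fin (Fintype.card T) → Option (Fin (Fintype.card T)) := fun x =>
    (par (E.symm x).1).map (fun p => E (t p))
  let dep' : Fin (Fintype.card T) → ℕ := fun x => d - ρ (E.symm x).1
  have hlt : ∀ (h : T) p, par h.1 = some p → ρ h.1 < ρ p := by
    intro h p hp
    refine lt_of_le_of_ne (hmono _ _ hp) ?_
    intro heq
    have h1 := f_eq _ _ hp heq
    rw [h.2] at h1
    have h2 := hdep _ _ hp
    rw [← h1] at h2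
    exact lt_irrefl _ h2
  have hdep' : ∀ x y, par' x = some y → dep' y < dep' x := by
    intro x y hxy
    simp only [par', Option.map_eq_some_iff] at hxy
    obtain ⟨p, hp, rfl⟩ := hxy
    simp only [dep', Equiv.symm_apply_apply, tρ]
    have h1 := hlt _ _ hp
    have h2 := hρ p
    omega
  refine ⟨⟨Fintype.card T, parGraph par'⟩, fun v => E (t v), ?_, ?_, ?_, ?_⟩
  · exact parGraph_mem_Fd hdep' (fun v => Nat.sub_le _ _)
  · intro v p hvp
    by_cases h' : ρ v = ρ p
    · left
      have := tf v
      rw [f_eq v p hvp h'] at this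
      dsimp only
      rw [this]
    · right
      dsimp only
      rw [parGraph_adj hdep']
      left
      have hv : f v = v := f_ne v p hvp h'
      have : t v = ⟨v, hv⟩ := tT ⟨v, hv⟩
      simp only [par', Equiv.symm_apply_apply, this, hvp, Option.map_some]
  · intro h
    have := fiber_iterate f (k + 1) ?_ e (E.symm h).1
    · refine le_trans (Set.ncard_le_ncard ?_ (Set.toFinite _)) this
      intro v hv
      change f^[e] v = _
      rw [← (show E (t v) = h from hv), Equiv.symm_apply_apply]
    · intro p
      refine le_trans (Set.ncard_le_ncard (t := insert p {v | par v = some p ∧ ρ v = ρ p})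
        ?_ (Set.toFinite _)) ?_
      · intro v hv
        replace hv : f v = p := hv
        rcases f_cases v with h | h
        · left
          rw [← hv, h]
        · right
          rw [hv] at h
          exact h
      · exact (Set.ncard_insert_le _ _).trans (Nat.add_le_add_right (hfew p) 1)
  · intro r hr huniq
    refine parGraph_mem_Td hdep' (fun v => Nat.sub_le _ _) (E ⟨r, f_none r hr⟩) ?_
    intro x hx
    simp only [par', Option.map_eq_none_iff] at hx
    have h2 := huniq _ hx
    have h3 : E.symm x = ⟨r, f_none r hr⟩ := Subtype.ext h2
    rw [← h3, Equiv.apply_symm_apply]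

lemma exists_inj_of_ncard {α : Type} [Finite α] {s : Set α} {k : ℕ} (h : k ≤ s.ncard) :
    ∃ c : Fin k → α, Function.Injective c ∧ ∀ i, c i ∈ s := by
  classical
  obtain ⟨t, hts, htk⟩ := Set.exists_subset_card_eq h
  have := Fintype.ofFinite α
  have e : Fin k ≃ t := by
    refine (Fintype.equivFinOfCardEq ?_).symm
    rw [← htk, ← Nat.card_coe_set_eq, Nat.card_eq_fintype_card]
  exact ⟨fun i => (e i).1, fun i j hij => e.injective (Subtype.ext hij), fun i => hts (e i).2⟩

/-- the capped rank -/
noncomputable def pRank {V : Type} (par : V → Option V) (k d : ℕ) (v : V) : ℕ :=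
  @Nat.findGreatest (fun j => PGood par k j v) (fun _ => Classical.propDecidable _) d

lemma pRank_le {V : Type} (par : V → Option V) (k d : ℕ) (v : V) : pRank par k d v ≤ d := by
  let : DecidablePred (fun j => PGood par k j v) := fun _ => Classical.propDecidable _
  exact Nat.findGreatest_le (P := fun j => PGood par k j v) d

lemma pRank_good {V : Type} (par : V → Option V) (k d : ℕ) (v : V) :
    PGood par k (pRank par k d v) v := by
  let : DecidablePred (fun j => PGood par k j v) := fun _ => Classical.propDecidable _
  exact Nat.findGreatest_spec (P := fun j => PGood par k j v) (Nat.zero_le d) (PGood.zero v)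

lemma le_pRank {V : Type} (par : V → Option V) (k d j : ℕ) (v : V) (hj : j ≤ d)
    (h : PGood par k j v) : j ≤ pRank par k d v := by
  let : DecidablePred (fun j => PGood par k j v) := fun _ => Classical.propDecidable _
  exact Nat.le_findGreatest (P := fun j => PGood par k j v) hj h

lemma pRank_mono {V : Type} (par : V → Option V) (k d : ℕ) (v p : V) (h : par v = some p) :
    pRank par k d v ≤ pRank par k d p :=
  le_pRank par k d _ p (pRank_le par k d v) (PGood.up _ v p h (pRank_good par k d v))

/-- Children of `p` of the same rank are few unless the rank is `d`. -/
lemma pRank_few {V : Type} [Finite V] (par : V → Option V) (k d : ℕ) (p : V)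
    (h : k ≤ {v | par v = some p ∧ pRank par k d v = pRank par k d p}.ncard) :
    ∃ c : Fin k → V, Function.Injective c ∧ (∀ i, par (c i) = some p) ∧
      (∀ i, PGood par k d (c i)) := by
  obtain ⟨c, hc, hcs⟩ := exists_inj_of_ncard h
  have hg : ∀ i, PGood par k (pRank par k d p) (c i) := fun i => by
    rw [← (hcs i).2]
    exact pRank_good par k d (c i)
  have hd : pRank par k d p = d := by
    by_contra hne
    have hle := pRank_le par k d p
    have h1 := le_pRank par k d (pRank par k d p + 1) p (by omega)
      (PGood.step _ p c hc (fun i => (hcs i).1) hg)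
    omega
  refine ⟨c, hc, fun i => (hcs i).1, ?_⟩
  rw [hd] at hg
  exact hg

/-! ### Deconstructions -/

lemma decon_of_map {α : Type} [Finite α] {G : SimpleGraph α} {β : Type} {H : SimpleGraph β}
    (t : α → β) (W : ℕ) (h1 : ∀ u v, G.Adj u v → reflAdj H (t u) (t v))
    (h2 : ∀ h, {v | t v = h}.ncard ≤ W) :
    IsDeconstruction G H (fun h => {v | t v = h}) ∧
      DeconWidthLE H (fun h => {v | t v = h}) (2 * W) := by
  refine ⟨⟨?_, ?_⟩, ?_⟩
  · intro g g' hg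
    refine ⟨t g, t g', ?_, Or.inl rfl, Or.inr rfl⟩
    rcases hg with rfl | hg
    · exact Or.inl rfl
    · exact h1 _ _ hg
  · intro g
    have : {h | g ∈ {v | t v = h}} = {t g} := by
      ext h
      simp [eq_comm]
    rw [this]
    exact connSet_singleton H _
  · intro h h' _
    refine (Set.ncard_union_le _ _).trans ?_
    have := h2 h
    have := h2 h'
    dsimp only
    omega

lemma decon_of_minor {α β X : Type} {F : SimpleGraph α} {G : SimpleGraph β}
    {M : SimpleGraph X} {μ : X → Set β} (hμ : IsMinorMap M G μ) (ψ : α → X)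
    (hψ : Function.Injective ψ) (hadj : ∀ u v, F.Adj u v → M.Adj (ψ u) (ψ v)) :
    IsDeconstruction F G (fun g => {v | g ∈ μ (ψ v)}) ∧
      DeconWidthLE G (fun g => {v | g ∈ μ (ψ v)}) 2 := by
  obtain ⟨h1, h2, h3⟩ := hμ
  refine ⟨⟨?_, fun g => h1 (ψ g)⟩, ?_⟩
  · intro g g' hg
    rcases hg with rfl | hg
    · obtain ⟨x⟩ := (show (G.induce (μ (ψ g))).Connected from h1 (ψ g)).nonempty
      exact ⟨x.1, x.1, Or.inl rfl, Or.inl x.2, Or.inl x.2⟩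
    · obtain ⟨x, hx, y, hy, hxy⟩ := h3 _ _ (hadj _ _ hg)
      exact ⟨x, y, Or.inr hxy, Or.inl hx, Or.inr hy⟩
  · have hone : ∀ g, {v | g ∈ μ (ψ v)}.ncard ≤ 1 := by
      intro g
      have hsub : {v | g ∈ μ (ψ v)}.Subsingleton := by
        intro u hu v hv
        by_contra hne
        exact Set.disjoint_left.1 (h2 _ _ (hψ.ne hne)) hu hv
      rcases hsub.eq_empty_or_singleton with h | ⟨x, h⟩ <;> simp [h]
    intro h h' _
    refine (Set.ncard_union_le _ _).trans ?_
    have := hone h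
    have := hone h'
    dsimp only
    omega

/-- Root and address string of a vertex. -/
def pAddr {V : Type} (par : V → Option V) (dep : V → ℕ)
    (hdep : ∀ v p, par v = some p → dep p < dep v) (v : V) : V × List V :=
  match hv : par v with
  | none => (v, [])
  | some p => ((pAddr par dep hdep p).1, v :: (pAddr par dep hdep p).2)
termination_by dep v
decreasing_by all_goals exact hdep _ _ hv

lemma pAddr_none {V : Type} (par : V → Option V) (dep : V → ℕ)
    (hdep : ∀ v p, par v = some p → dep p < dep v) (v : V) (hv : par v = none) :
    pAddr par dep hdep v = (v, []) := by
  rw [pAddr]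
  split
  · rfl
  · rename_i p hp
    rw [hv] at hp
    simp at hp

lemma pAddr_some {V : Type} (par : V → Option V) (dep : V → ℕ)
    (hdep : ∀ v p, par v = some p → dep p < dep v) (v p : V) (hv : par v = some p) :
    pAddr par dep hdep v = ((pAddr par dep hdep p).1, v :: (pAddr par dep hdep p).2) := by
  rw [pAddr]
  split
  · rename_i hp
    rw [hv] at hp
    simp at hp
  · rename_i q hq
    rw [hv] at hq
    simp only [Option.some.injEq] at hq
    subst hq
    rfl

lemma pAddr_length {V : Type} (par : V → Option V) (dep : V → ℕ)
    (hdep : ∀ v p, par v = some p → dep p < dep v) (v : V) :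
    (pAddr par dep hdep v).2.length ≤ dep v := by
  induction hn : dep v using Nat.strong_induction_on generalizing v with
  | _ n ih =>
    subst hn
    cases hv : par v with
    | none =>
      rw [pAddr_none par dep hdep v hv]
      simp
    | some p =>
      rw [pAddr_some par dep hdep v p hv]
      have h1 := hdep _ _ hv
      have h2 := ih _ h1 p rfl
      simp only [List.length_cons]
      omega

lemma pAddr_inj {V : Type} (par : V → Option V) (dep : V → ℕ)
    (hdep : ∀ v p, par v = some p → dep p < dep v) (u v : V)
    (hroot : par u = none → par v = none → u = v)
    (h : (pAddr par dep hdep u).2 = (pAddr par dep hdep v).2) : u = v := by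
  cases hu : par u with
  | none =>
    cases hv : par v with
    | none => exact hroot hu hv
    | some q =>
      rw [pAddr_none par dep hdep u hu, pAddr_some par dep hdep v q hv] at h
      simp at h
  | some p =>
    cases hv : par v with
    | none =>
      rw [pAddr_some par dep hdep u p hu, pAddr_none par dep hdep v hv] at h
      simp at h
    | some q =>
      rw [pAddr_some par dep hdep u p hu, pAddr_some par dep hdep v q hv] at h
      simp only [List.cons.injEq] at h
      exact h.1

/-- The address as a vertex of `T_{d, n+1}`. -/
def pStr {n d : ℕ} (par : Fin n → Option (Fin n)) (dep : Fin n → ℕ)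
    (hdep : ∀ v p, par v = some p → dep p < dep v) (hd : ∀ v, dep v ≤ d) (v : Fin n) :
    {l : List (Fin (n + 1)) // l.length ≤ d} :=
  ⟨(pAddr par dep hdep v).2.map Fin.castSucc, by
    rw [List.length_map]
    exact (pAddr_length par dep hdep v).trans (hd v)⟩

lemma pStr_eq {n d : ℕ} (par : Fin n → Option (Fin n)) (dep : Fin n → ℕ)
    (hdep : ∀ v p, par v = some p → dep p < dep v) (hd : ∀ v, dep v ≤ d) (u v : Fin n)
    (h : pStr par dep hdep hd u = pStr par dep hdep hd v) :
    (pAddr par dep hdep u).2 = (pAddr par dep hdep v).2 :=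
  (List.map_injective_iff.2 (Fin.castSucc_injective n)) (congrArg Subtype.val h)

lemma pStr_adj {n d : ℕ} (par : Fin n → Option (Fin n)) (dep : Fin n → ℕ)
    (hdep : ∀ v p, par v = some p → dep p < dep v) (hd : ∀ v, dep v ≤ d) (v p : Fin n)
    (h : par v = some p) :
    (kAryTree d (n + 1)).Adj (pStr par dep hdep hd v) (pStr par dep hdep hd p) := by
  unfold kAryTree
  have h1 : (pStr par dep hdep hd v).1 = Fin.castSucc v :: (pStr par dep hdep hd p).1 := by
    simp only [pStr]
    rw [pAddr_some par dep hdep v p h]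
    simp
  rw [SimpleGraph.fromRel_adj]
  refine ⟨?_, Or.inr ⟨_, h1⟩⟩
  intro h2
  rw [h2] at h1
  simpa using congrArg List.length h1

/-- Many disjoint complete trees appear as minors. -/
def MultiAll (𝒢 : Set FinGraph) (d : ℕ) : Prop :=
  ∀ k : ℕ, 1 ≤ k → ∃ G ∈ 𝒢, ∃ μ : Fin k × {l : List (Fin k) // l.length ≤ d} → Set (Fin G.n),
    IsMinorMap ((⊥ : SimpleGraph (Fin k)) □ kAryTree d k) G.G μ

lemma Td_le_of_stack (𝒢 : Set FinGraph) (d : ℕ) (h : StackAll 𝒢 d) :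
    DeconLE (classTd d) 𝒢 := by
  refine ⟨2, ?_⟩
  rintro F ⟨hF, r, hr⟩
  obtain ⟨par, dep, hdep, hd, hadj, huniq⟩ := exists_par F d hF.isAcyclic
    (fun v => ⟨r, hF.connected r v, fun u _ => hr u⟩)
  obtain ⟨G, hG, μ, hμ⟩ := h (F.n + 1) (by omega)
  refine ⟨G, hG, _, decon_of_minor hμ (pStr par dep hdep hd) ?_ ?_⟩
  · intro u v huv
    exact pAddr_inj par dep hdep u v (fun h1 h2 => huniq u v h1 h2 (hF.connected u v))
      (pStr_eq par dep hdep hd u v huv)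
  · intro u v huv
    rcases (hadj u v).1 huv with h | h
    · exact pStr_adj par dep hdep hd _ _ h
    · exact (pStr_adj par dep hdep hd _ _ h).symm

lemma Fd_le_of_multi (𝒢 : Set FinGraph) (d : ℕ) (h : MultiAll 𝒢 d) :
    DeconLE (classFd d) 𝒢 := by
  refine ⟨2, ?_⟩
  rintro F ⟨hF, hh⟩
  obtain ⟨par, dep, hdep, hd, hadj, -⟩ := exists_par F d hF hh
  obtain ⟨G, hG, μ, hμ⟩ := h (F.n + 1) (by omega)
  have key : ∀ v p, par v = some p →
      ((⊥ : SimpleGraph (Fin (F.n + 1))) □ kAryTree d (F.n + 1)).Adj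
        ((pAddr par dep hdep v).1.castSucc, pStr par dep hdep hd v)
        ((pAddr par dep hdep p).1.castSucc, pStr par dep hdep hd p) := by
    intro v p hvp
    rw [SimpleGraph.boxProd_adj]
    right
    refine ⟨pStr_adj par dep hdep hd _ _ hvp, ?_⟩
    rw [pAddr_some par dep hdep v p hvp]
  refine ⟨G, hG, _, decon_of_minor hμ
    (fun v => ((pAddr par dep hdep v).1.castSucc, pStr par dep hdep hd v)) ?_ ?_⟩
  · intro u v huv
    simp only [Prod.mk.injEq] at huv
    refine pAddr_inj par dep hdep u v (fun h1 h2 => ?_) (pStr_eq par dep hdep hd u v huv.2)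
    have := Fin.castSucc_injective _ huv.1
    rw [pAddr_none par dep hdep u h1, pAddr_none par dep hdep v h2] at this
    exact this
  · intro u v huv
    rcases (hadj u v).1 huv with h | h
    · exact key _ _ h
    · exact (key _ _ h).symm

lemma le_Fd (𝒢 : Set FinGraph) (e : ℕ) (hforest : ∀ G ∈ 𝒢, G.G.IsAcyclic)
    (hheight : ∀ G ∈ 𝒢, forestHeightLE G e) (d : ℕ) (h : ¬ StackAll 𝒢 (d + 1)) :
    DeconLE 𝒢 (classFd d) := by
  unfold StackAll at h
  push Not at h
  obtain ⟨k, hk, h⟩ := h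
  refine ⟨2 * (k + 1) ^ e, ?_⟩
  intro G hG
  obtain ⟨par, dep, hdep, he, hadj, -⟩ := exists_par G e (hforest G hG) (hheight G hG)
  obtain ⟨H, t, hH, h1, h2, -⟩ := contract par dep hdep e d k he (pRank par k d)
    (pRank_le par k d) (pRank_mono par k d) (by
      intro p
      by_contra hlt
      obtain ⟨c, hc, hcp, hcg⟩ := pRank_few par k d p (by omega)
      obtain ⟨ν, hν⟩ := (PGood.step d p c hc hcp hcg).strMinor (G := G.G) hdep
        (fun u v huv => (hadj u v).2 (Or.inl huv))
      exact h G hG _ hν.isMinorMap)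
  refine ⟨H, hH, _, decon_of_map t _ ?_ h2⟩
  intro u v huv
  rcases (hadj u v).1 huv with h | h
  · exact h1 _ _ h
  · rcases h1 _ _ h with h' | h'
    · exact Or.inl h'.symm
    · exact Or.inr h'.symm

lemma le_Td (𝒢 : Set FinGraph) (e : ℕ) (hforest : ∀ G ∈ 𝒢, G.G.IsAcyclic)
    (hheight : ∀ G ∈ 𝒢, forestHeightLE G e) (d : ℕ) (h : ¬ MultiAll 𝒢 d) :
    DeconLE 𝒢 (classTd d) := by
  unfold MultiAll at h
  push Not at h
  obtain ⟨k, hk, h⟩ := h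
  refine ⟨2 * (k + 1) ^ (e + 1), ?_⟩
  intro G hG
  obtain ⟨par, dep, hdep, he, hadj, -⟩ := exists_par G e (hforest G hG) (hheight G hG)
  have hno : ∀ (q : Option (Fin G.n)) (c : Fin k → Fin G.n), Function.Injective c →
      (∀ i, par (c i) = q) → (∀ i, PGood par k d (c i)) → False := by
    intro q c hc hcq hcg
    have := fun i => (hcg i).strMinor (G := G.G) hdep
        (fun u v huv => (hadj u v).2 (Or.inl huv))
    choose ν hν using this
    refine h G hG (fun x => ν x.1 x.2.1.reverse) ⟨?_, ?_, ?_⟩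
    · rintro ⟨i, l⟩
      exact (hν i).isMinorMap.1 l
    · rintro ⟨i, l⟩ ⟨i', l'⟩ hne
      by_cases hi : i = i'
      · subst hi
        exact (hν i).isMinorMap.2.1 l l' (fun h => hne (by rw [h]))
      · have := PDesc.disjoint_sibling hdep (hc.ne hi) ((hcq i).trans (hcq i').symm)
        exact this.mono ((hν i).2.1 _ (by simpa using l.2)).2
          ((hν i').2.1 _ (by simpa using l'.2)).2
    · rintro ⟨i, l⟩ ⟨i', l'⟩ hadj'
      rw [SimpleGraph.boxProd_adj] at hadj'
      rcases hadj' with h' | ⟨h', hi⟩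
      · exact absurd h'.1 (by simp)
      · dsimp only at hi h'
        subst hi
        exact (hν i).isMinorMap.2.2 l l' h'
  let par' : Option (Fin G.n) → Option (Option (Fin G.n)) := fun x => x.map par
  let dep' : Option (Fin G.n) → ℕ := fun x => x.elim 0 (fun v => dep v + 1)
  let ρ : Option (Fin G.n) → ℕ := fun x => x.elim d (pRank par k d)
  have hdep' : ∀ v p, par' v = some p → dep' p < dep' v := by
    rintro (_ | v) p hvp
    · simp [par'] at hvp
    · simp only [par', Option.map_some, Option.some.injEq] at hvp
      cases p with
      | none => simp [dep']
      | some p => simpa [dep'] using hdep _ _ hvp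
  obtain ⟨H, t, -, h1, h2, h3⟩ := contract par' dep' hdep' (e + 1) d k
    (by
      rintro (_ | v)
      · simp [dep']
      · simpa [dep'] using he v) ρ
    (by
      rintro (_ | v)
      · simp [ρ]
      · simpa [ρ] using pRank_le par k d v)
    (by
      rintro (_ | v) p hvp
      · simp [par'] at hvp
      · simp only [par', Option.map_some, Option.some.injEq] at hvp
        cases p with
        | none => simpa [ρ] using pRank_le par k d v
        | some p => simpa [ρ] using pRank_mono par k d v p hvp)
    (by
      intro p
      by_contra hlt
      have himg : {v | par' v = some p ∧ ρ v = ρ p} =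
          some '' {v | par v = p ∧ pRank par k d v = ρ p} := by
        ext v
        cases v with
        | none => simp [par']
        | some v => simp [par', ρ]
      rw [himg, Set.ncard_image_of_injective _ (Option.some_injective _)] at hlt
      cases p with
      | none =>
        obtain ⟨c, hc, hcs⟩ := exists_inj_of_ncard (s := {v | par v = none ∧
          pRank par k d v = ρ none}) (k := k) (by omega)
        refine hno none c hc (fun i => (hcs i).1) (fun i => ?_)
        have := pRank_good par k d (c i)
        rw [(hcs i).2] at this
        exact this
      | some p =>
        obtain ⟨c, hc, hcp, hcg⟩ := pRank_few par k d p (by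
          simp only [ρ, Option.elim_some] at hlt
          omega)
        exact hno _ c hc hcp hcg)
  have hH : H ∈ classTd d := h3 none rfl (by
    rintro (_ | v) hv
    · rfl
    · simp [par'] at hv)
  refine ⟨H, hH, _, decon_of_map (fun v => t (some v)) ((k + 1) ^ (e + 1)) ?_ ?_⟩
  · intro u v huv
    rcases (hadj u v).1 huv with h | h
    · exact h1 (some u) (some v) (by simp [par', h])
    · rcases h1 (some v) (some u) (by simp [par', h]) with h' | h'
      · exact Or.inl h'.symm
      · exact Or.inr h'.symm
  · intro h
    refine le_trans ?_ (h2 h)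
    rw [← Set.ncard_image_of_injective _ (Option.some_injective _)]
    apply Set.ncard_le_ncard _ (Set.toFinite _)
    rintro _ ⟨v, hv, rfl⟩
    exact hv

/-- if `𝒢` is a class of finite forests of bounded height and `d`
is its stack depth, then `𝒢 ≡ 𝒯_d` or `𝒢 ≡ ℱ_d`. -/
theorem stack_depth_in_hierarchy (𝒢 : Set FinGraph) (e : ℕ)
    (hforest : ∀ G ∈ 𝒢, G.G.IsAcyclic)
    (hheight : ∀ G ∈ 𝒢, forestHeightLE G e)
    (d : ℕ) (hsd : HasStackDepth 𝒢 d) :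
    DeconEquiv 𝒢 (classTd d) ∨ DeconEquiv 𝒢 (classFd d) := by

  by_cases hm : MultiAll 𝒢 d
  · exact Or.inr ⟨le_Fd 𝒢 e hforest hheight d hsd.2, Fd_le_of_multi 𝒢 d hm⟩
  · exact Or.inl ⟨le_Td 𝒢 e hforest hheight d hm, Td_le_of_stack 𝒢 d hsd.1⟩
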